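/- Let A be a finite-dimensional C-algebra, A' its maximal semisimple quotient as an R_A-module, and Ā the quotient of A' by the kernel of the E_A-action. Then Ā is a semisimple C-algebra (a finite direct sum of simple C-algebras). In particular, A is semisimple if and only if Rad(A) = 0, where Rad(A) is the kernel of the projection A → Ā. -/

import Mathlib

/-- Data of a linear operad: spaces of `n`-ary operations, an identity operation,
and partial compositions. -/
structure LinearOperadData (F : Type) [Field F] where
  C : ℕ → Type
  one : C 1
  comp : ∀ {m n : ℕ}, C m → C n → Fin m → C (m + n - 1)

/-- An algebra over (the data of) a linear operad: structure maps
`α n : C n → MultilinearMap`, compatible with identity and composition. -/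
structure OperadAlgebraOn (F : Type) [Field F] (O : LinearOperadData F)
    (A : Type) [AddCommGroup A] [Module F A] where
  α : ∀ n, O.C n → MultilinearMap F (fun _ : Fin n => A) A
  α_one : ∀ a : A, α 1 O.one (fun _ => a) = a
  α_comp : ∀ {m n : ℕ} (c : O.C m) (d : O.C n) (i : Fin m) (v : Fin (m + n - 1) → A),
    α (m + n - 1) (O.comp c d i) v =
      α m c (fun k =>
        if hk : (k : ℕ) < (i : ℕ) then v ⟨k, by have := k.isLt; have := i.isLt; omega⟩
        else if hk2 : (k : ℕ) = (i : ℕ) then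
          α n d (fun j => v ⟨(i : ℕ) + (j : ℕ), by have := j.isLt; have := i.isLt; omega⟩)
        else v ⟨(k : ℕ) + n - 1, by have := k.isLt; have := i.isLt; omega⟩)

variable {F : Type} [Field F] {O : LinearOperadData F}
variable {A : Type} [AddCommGroup A] [Module F A]

/-- The partial multiplication operator `a ↦ α n c (v_1,...,a at slot j,...,v_{n-1})`. -/
def OperadAlgebraOn.op (OA : OperadAlgebraOn F O A) {n : ℕ} (c : O.C n)
    (v : Fin n → A) (j : Fin n) : Module.End F A :=
  (OA.α n c).toLinearMap v j

/-- `E_A`: the span of the partial multiplication operators with `n ≥ 2` inputs. -/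
def EA (OA : OperadAlgebraOn F O A) : Submodule F (Module.End F A) :=
  Submodule.span F
    {T | ∃ n : ℕ, 2 ≤ n ∧ ∃ (c : O.C n) (v : Fin n → A) (j : Fin n), T = OA.op c v j}

/-- `L_A`: the image of `C(1)` in `End_F(A)`. -/
def LA (OA : OperadAlgebraOn F O A) : Submodule F (Module.End F A) :=
  Submodule.span F {T | ∃ c : O.C 1, T = OA.op c (fun _ => (0 : A)) 0}

/-- `R_A = L_A + E_A`. -/
def RA (OA : OperadAlgebraOn F O A) : Submodule F (Module.End F A) :=
  LA OA ⊔ EA OA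

/-- A subspace `I ⊆ A` is an ideal: closed under all operadic operations whenever
at least one argument lies in `I`. -/
def IsIdealPred (OA : OperadAlgebraOn F O A) (I : Submodule F A) : Prop :=
  ∀ (n : ℕ) (c : O.C n) (v : Fin n → A) (j : Fin n), v j ∈ I → OA.α n c v ∈ I

/-- A relative ideal `J` of the subalgebra `P ⊆ A`. -/
def IsIdealIn (OA : OperadAlgebraOn F O A) (P J : Submodule F A) : Prop :=
  J ≤ P ∧ ∀ (n : ℕ) (c : O.C n) (v : Fin n → A) (j : Fin n),
    (∀ k, v k ∈ P) → v j ∈ J → OA.α n c v ∈ J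

/-- The multiplications (with `n ≥ 2`) of `A` do not all vanish on the subspace `P`. -/
def HasNonzeroMul (OA : OperadAlgebraOn F O A) (P : Submodule F A) : Prop :=
  ∃ n : ℕ, 2 ≤ n ∧ ∃ (c : O.C n) (v : Fin n → A), (∀ k, v k ∈ P) ∧ OA.α n c v ≠ 0

/-- `P` is a simple summand: an ideal of `A`, with no nontrivial subideals,
on which the multiplication is nonzero. -/
def IsSimplePiece (OA : OperadAlgebraOn F O A) (P : Submodule F A) : Prop :=
  IsIdealPred OA P ∧ (∀ J ≤ P, IsIdealPred OA J → J = ⊥ ∨ J = P) ∧ HasNonzeroMul OA P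

/-- `A` is a simple `C`-algebra: the only ideals are `0` and `A`, and `E_A ≠ 0`. -/
def IsSimpleAlg (OA : OperadAlgebraOn F O A) : Prop :=
  (∀ I : Submodule F A, IsIdealPred OA I → I = ⊥ ∨ I = ⊤) ∧ EA OA ≠ ⊥

/-- `A` is a semisimple `C`-algebra: a finite direct sum of simple `C`-algebras. -/
def IsSemisimpleAlg (OA : OperadAlgebraOn F O A) : Prop :=
  ∃ (m : ℕ) (P : Fin m → Submodule F A),
    iSupIndep P ∧ (⨆ i, P i) = ⊤ ∧ ∀ i, IsSimplePiece OA (P i)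

/-- The group of `C`-algebra automorphisms of `A`, as a subgroup of `A ≃ₗ[F] A`. -/
def AlgAutGroup (OA : OperadAlgebraOn F O A) : Subgroup (A ≃ₗ[F] A) where
  carrier := {f | ∀ (n : ℕ) (c : O.C n) (v : Fin n → A),
    f (OA.α n c v) = OA.α n c (fun k => f (v k))}
  one_mem' := by intro n c v; rfl
  mul_mem' := by
    intro f g hf hg n c v
    show f (g (OA.α n c v)) = _
    rw [hg, hf]
    rfl
  inv_mem' := by
    intro f hf n c v
    have h1 : ∀ x : A, f (f⁻¹ x) = x := fun x => f.apply_symm_apply x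
    apply f.injective
    rw [h1, hf]
    simp only [h1]

/-- A maximal (proper) ideal of `A`. -/
def IsMaxIdeal (OA : OperadAlgebraOn F O A) (M : Submodule F A) : Prop :=
  IsIdealPred OA M ∧ M ≠ ⊤ ∧ ∀ J, IsIdealPred OA J → M < J → J = ⊤

/-- The kernel of the projection to the maximal semisimple quotient of `A`
as an `R_A`-module (the intersection of the maximal ideals). -/
def preRad (OA : OperadAlgebraOn F O A) : Submodule F A :=
  sInf {M | IsMaxIdeal OA M}

/-- The radical of the `C`-algebra `A`: the kernel of `A → Ā`, where `Ā` is the quotient of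
the maximal semisimple `R_A`-module quotient `A' = A / preRad` by the kernel of the
`E_A`-action. -/
def radAlg (OA : OperadAlgebraOn F O A) : Submodule F A :=
  ⨅ (e : Module.End F A) (_ : e ∈ EA OA), (preRad OA).comap e

/-- An operad algebra structure on `A ⧸ I` compatible with the projection. -/
def IsQuotientAlg (OA : OperadAlgebraOn F O A) (I : Submodule F A)
    (OQ : OperadAlgebraOn F O (A ⧸ I)) : Prop :=
  ∀ (n : ℕ) (c : O.C n) (v : Fin n → A),
    I.mkQ (OA.α n c v) = OQ.α n c (fun k => I.mkQ (v k))

/-- A componentwise ("pointwise") operad algebra structure on a product. -/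
def IsComponentwiseAlg {ι : Type} {B : ι → Type} [∀ i, AddCommGroup (B i)]
    [∀ i, Module F (B i)] (OB : ∀ i, OperadAlgebraOn F O (B i))
    (OP : OperadAlgebraOn F O (∀ i, B i)) : Prop :=
  ∀ (n : ℕ) (c : O.C n) (v : Fin n → ∀ i, B i) (i : ι),
    OP.α n c v i = (OB i).α n c (fun k => v k i)

/-- Pointwise algebra structure on `ι → B`. -/
def IsPointwiseAlg {ι B : Type} [AddCommGroup B] [Module F B]
    (OB : OperadAlgebraOn F O B) (OP : OperadAlgebraOn F O (ι → B)) : Prop :=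
  ∀ (n : ℕ) (c : O.C n) (v : Fin n → ι → B) (i : ι),
    OP.α n c v i = OB.α n c (fun k => v k i)

/-- Block-diagonal inclusion `End(B i) → End(Π j, B j)`. -/
def blkMap {ι : Type} [DecidableEq ι] (B : ι → Type) [∀ i, AddCommGroup (B i)]
    [∀ i, Module F (B i)] (i : ι) :
    Module.End F (B i) →ₗ[F] Module.End F (∀ j, B j) where
  toFun T := (LinearMap.single F B i) ∘ₗ T ∘ₗ (LinearMap.proj i)
  map_add' := by
    intro T S
    ext v j
    simp [Pi.single_add]
  map_smul' := by
    intro t T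
    ext v j
    simp [Pi.single_smul]

/-- The action of `Perm ι` on `ι → K` by permuting coordinates. -/
def permAct (ι K : Type) [Group K] : Equiv.Perm ι →* MulAut (ι → K) where
  toFun σ :=
    { toFun := fun f => f ∘ σ.symm
      invFun := fun f => f ∘ σ
      left_inv := fun f => by funext x; simp
      right_inv := fun f => by funext x; simp
      map_mul' := fun f g => rfl }
  map_one' := by
    ext f x
    rfl
  map_mul' := by
    intro σ τ
    ext f x
    rfl

/-- Right translation action of `G` on `G → B`. -/
def rightTrans (G B : Type) [Group G] (g : G) : (G → B) → (G → B) :=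
  fun f x => f (x * g)

/-- The space `Fun_H(G, B)` of `H`-equivariant functions `G → B`. -/
def FunHsub (G : Type) [Group G] (B : Type) [AddCommGroup B] [Module F B]
    (H : Subgroup G) (OB : OperadAlgebraOn F O B) (φ : H →* AlgAutGroup OB) :
    Submodule F (G → B) where
  carrier := {f | ∀ (h : H) (x : G),
    f ((h : G) * x) = ((φ h : AlgAutGroup OB) : B ≃ₗ[F] B) (f x)}
  add_mem' := by
    intro f g hf hg h x
    simp [hf h x, hg h x]
  zero_mem' := by intro h x; simp
  smul_mem' := by
    intro t f hf h x
    simp [hf h x]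

/-- A bundled `C`-algebra (used for existential quantification over algebras). -/
structure OperadAlgBundle (F : Type) [Field F] (O : LinearOperadData F) where
  carrier : Type
  [acg : AddCommGroup carrier]
  [mod : Module F carrier]
  alg : OperadAlgebraOn F O carrier

attribute [instance] OperadAlgBundle.acg OperadAlgBundle.mod

/-- `(A, ρ)` is modeled by `Fun_H(G, B)` for the pair `(H, φ)`:
there is an injective `G`-equivariant `C`-algebra map of `A` onto the subalgebra
`Fun_H(G, B)` of the pointwise algebra `G → B`, where `B` is simple and `G` acts by
right translation. -/
def IsFunHModel {G : Type} [Group G] (OA : OperadAlgebraOn F O A)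
    (ρ : G →* (A ≃ₗ[F] A)) (H : Subgroup G) (Bb : OperadAlgBundle F O)
    (φ : H →* AlgAutGroup Bb.alg) : Prop :=
  IsSimpleAlg Bb.alg ∧
  ∃ OGB : OperadAlgebraOn F O (G → Bb.carrier),
    IsPointwiseAlg Bb.alg OGB ∧
    ∃ e : A →ₗ[F] (G → Bb.carrier), Function.Injective e ∧
      LinearMap.range e = FunHsub G Bb.carrier H Bb.alg φ ∧
      (∀ (n : ℕ) (c : O.C n) (v : Fin n → A),
        e (OA.α n c v) = OGB.α n c fun k => e (v k)) ∧
      (∀ (g : G) (a : A) (x : G), e (ρ g a) x = e a (x * g))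

namespace OperadAlgebraOn

variable (OA : OperadAlgebraOn F O A)

theorem op_apply {n : ℕ} (c : O.C n) (v : Fin n → A) (j : Fin n) (x : A) :
    OA.op c v j x = OA.α n c (Function.update v j x) := rfl

theorem op_apply_self {n : ℕ} (c : O.C n) (v : Fin n → A) (j : Fin n) :
    OA.op c v j (v j) = OA.α n c v := by
  rw [op_apply, Function.update_eq_self]

theorem exists_op_comp {m n : ℕ} (c : O.C m) (d : O.C n) (v : Fin m → A) (w : Fin n → A)
    (i : Fin m) (j : Fin n) :
    ∃ (u : Fin (m + n - 1) → A) (l : Fin (m + n - 1)),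
      ∀ x, OA.op c v i (OA.op d w j x) = OA.op (O.comp c d i) u l x := by
  have hi := i.isLt
  have hj := j.isLt
  refine ⟨fun k => if h : (k : ℕ) < i then v ⟨k, by omega⟩
    else if h' : (k : ℕ) < i + n then w ⟨k - i, by omega⟩
    else v ⟨k + 1 - n, by have := k.isLt; omega⟩, ⟨i + j, by omega⟩, fun x => ?_⟩
  rw [op_apply, op_apply, op_apply, OA.α_comp]
  congr 1
  funext k
  have hk := k.isLt
  rcases lt_trichotomy (k : ℕ) i with h | h | h
  · have hne : k ≠ i := fun e => by simp [e] at h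
    simp only [Function.update_of_ne hne, h, dif_pos]
    rw [Function.update_of_ne (by simp only [ne_eq, Fin.mk.injEq]; omega)]
    simp [h]
  · obtain rfl : k = i := Fin.ext h
    simp only [Function.update_self, lt_irrefl, dif_neg, dif_pos, not_false_eq_true]
    congr 1
    funext l
    have hl := l.isLt
    by_cases e : l = j
    · subst e
      simp
    · have e' : (l : ℕ) ≠ j := fun h => e (Fin.ext h)
      rw [Function.update_of_ne e,
        Function.update_of_ne (by simp only [ne_eq, Fin.mk.injEq]; omega)]
      simp
  · have hne : k ≠ i := fun e => by simp [e] at h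
    have h1 : ¬ (k : ℕ) < i := by omega
    have h2 : ¬ (k : ℕ) = i := by omega
    rw [Function.update_of_ne hne, dif_neg h1, dif_neg h2,
      Function.update_of_ne (by simp only [ne_eq, Fin.mk.injEq]; omega),
      dif_neg (by simp only; omega), dif_neg (by simp only; omega)]
    congr 1
    ext
    simp only
    omega

theorem op_mem_EA {n : ℕ} (hn : 2 ≤ n) (c : O.C n) (v : Fin n → A) (j : Fin n) :
    OA.op c v j ∈ EA OA :=
  Submodule.subset_span ⟨n, hn, c, v, j, rfl⟩

theorem EA_apply_mem_iff {S : Submodule F A} {x : A} :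
    (∀ e ∈ EA OA, e x ∈ S) ↔
      ∀ n, 2 ≤ n → ∀ (c : O.C n) (v : Fin n → A) (j : Fin n), v j = x → OA.α n c v ∈ S := by
  constructor
  · rintro h n hn c v j rfl
    exact OA.op_apply_self c v j ▸ h _ (OA.op_mem_EA hn c v j)
  · intro h e he
    induction he using Submodule.span_induction with
    | mem T hT =>
      obtain ⟨n, hn, c, v, j, rfl⟩ := hT
      exact h n hn c _ j (Function.update_self j x v)
    | zero => exact S.zero_mem
    | add T U _ _ hT hU => exact S.add_mem hT hU
    | smul t T _ hT => exact S.smul_mem t hT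

/-- The unital algebra of operators on `A` generated by all partial multiplication operators.
Its submodules in `A` are the ideals of `A`. -/
def mulAlg : Subalgebra F (Module.End F A) :=
  Algebra.adjoin F {T | ∃ (n : ℕ) (c : O.C n) (v : Fin n → A) (j : Fin n), T = OA.op c v j}

end OperadAlgebraOn

namespace IsIdealPred

variable {OA : OperadAlgebraOn F O A} {I J : Submodule F A}

theorem op_mem (hI : IsIdealPred OA I) {n : ℕ} (c : O.C n) (v : Fin n → A) (j : Fin n) {x : A}
    (hx : x ∈ I) : OA.op c v j x ∈ I :=
  hI n c _ j (by simpa using hx)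

theorem of_op_mem
    (h : ∀ (n : ℕ) (c : O.C n) (v : Fin n → A) (j : Fin n), ∀ x ∈ I, OA.op c v j x ∈ I) :
    IsIdealPred OA I := fun n c v j hv => OA.op_apply_self c v j ▸ h n c v j _ hv

theorem EA_apply_mem (hI : IsIdealPred OA I) {x : A} (hx : x ∈ I) {e : Module.End F A}
    (he : e ∈ EA OA) : e x ∈ I :=
  OA.EA_apply_mem_iff.2 (fun n _ c v j hv => hI n c v j (hv ▸ hx)) e he

theorem inf (hI : IsIdealPred OA I) (hJ : IsIdealPred OA J) : IsIdealPred OA (I ⊓ J) :=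
  fun n c v j hv => ⟨hI n c v j hv.1, hJ n c v j hv.2⟩

theorem sInf {S : Set (Submodule F A)} (hS : ∀ I ∈ S, IsIdealPred OA I) :
    IsIdealPred OA (sInf S) := fun n c v j hv =>
  Submodule.mem_sInf.2 fun I hI => hS I hI n c v j (Submodule.mem_sInf.1 hv I hI)

theorem iSup {ι : Sort*} {I : ι → Submodule F A} (hI : ∀ i, IsIdealPred OA (I i)) :
    IsIdealPred OA (⨆ i, I i) := of_op_mem fun n c v j => by
  change (⨆ i, I i) ≤ (⨆ i, I i).comap (OA.op c v j)
  exact iSup_le fun i x hx => Submodule.mem_iSup_of_mem i ((hI i).op_mem c v j hx)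

theorem sup (hI : IsIdealPred OA I) (hJ : IsIdealPred OA J) : IsIdealPred OA (I ⊔ J) := by
  rw [sup_eq_iSup]
  exact iSup fun b => by cases b <;> assumption

/-- An ideal as a submodule over the algebra of multiplication operators. -/
def toSubmodule (hI : IsIdealPred OA I) : Submodule OA.mulAlg A :=
  { I with
    smul_mem' := by
      rintro ⟨T, hT⟩ x hx
      change T x ∈ I
      induction hT using Algebra.adjoin_induction generalizing x with
      | mem T hT =>
        obtain ⟨n, c, v, j, rfl⟩ := hT
        exact hI.op_mem c v j hx
      | algebraMap r => exact I.smul_mem r hx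
      | add T U _ _ hT hU => exact I.add_mem (hT hx) (hU hx)
      | mul T U _ _ hT hU => exact hT (hU hx) }

@[simp]
theorem mem_toSubmodule (hI : IsIdealPred OA I) {x : A} : x ∈ hI.toSubmodule ↔ x ∈ I := Iff.rfl

theorem restrictScalars (N : Submodule OA.mulAlg A) : IsIdealPred OA (N.restrictScalars F) :=
  of_op_mem fun n c v j _ hx =>
    N.smul_mem ⟨OA.op c v j, Algebra.subset_adjoin ⟨n, c, v, j, rfl⟩⟩ hx

/-- With respect to complementary ideals `P` and `Q`, a product with a factor in `P` only depends
on the `P`-components of the other factors. -/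
theorem exists_eq_of_isCompl {P Q : Submodule F A} (hP : IsIdealPred OA P)
    (hQ : IsIdealPred OA Q) (h : IsCompl P Q) {n : ℕ} (c : O.C n) (v : Fin n → A) (j : Fin n)
    (hj : v j ∈ P) : ∃ w : Fin n → A, (∀ k, w k ∈ P) ∧ OA.α n c v = OA.α n c w := by
  have hdec (k : Fin n) : ∃ p ∈ P, ∃ q ∈ Q, p + q = v k :=
    Submodule.mem_sup.1 (h.sup_eq_top ▸ Submodule.mem_top)
  choose p hp q hq hpq using hdec
  have hqj : q j = 0 := Submodule.disjoint_def.1 h.disjoint _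
    (by simpa [← hpq j] using P.sub_mem hj (hp j)) (hq j)
  refine ⟨p, hp, ?_⟩
  rw [← funext hpq, ← Pi.add_def, MultilinearMap.map_add_univ,
    Finset.sum_eq_single_of_mem Finset.univ (Finset.mem_univ _), Finset.piecewise_univ]
  intro s _ hs
  obtain ⟨k, hk⟩ : ∃ k, k ∉ s := by simpa [Finset.eq_univ_iff_forall] using hs
  refine Submodule.disjoint_def.1 h.disjoint _ (hP n c _ j ?_) (hQ n c _ k (by simp [hk, hq]))
  by_cases hjs : j ∈ s <;> simp [hjs, hp, hqj]

end IsIdealPred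

theorem mem_radAlg {OA : OperadAlgebraOn F O A} {x : A} :
    x ∈ radAlg OA ↔ ∀ e ∈ EA OA, e x ∈ preRad OA := by
  simp [radAlg, Submodule.mem_iInf]

theorem isIdealPred_preRad (OA : OperadAlgebraOn F O A) : IsIdealPred OA (preRad OA) :=
  IsIdealPred.sInf fun _ hM => hM.1

theorem preRad_le_radAlg (OA : OperadAlgebraOn F O A) : preRad OA ≤ radAlg OA :=
  fun _ hx => mem_radAlg.2 fun _ he => (isIdealPred_preRad OA).EA_apply_mem hx he

theorem isIdealPred_radAlg (OA : OperadAlgebraOn F O A) : IsIdealPred OA (radAlg OA) := by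
  refine .of_op_mem fun n c v j x hx => mem_radAlg.2 <| OA.EA_apply_mem_iff.2 ?_
  rintro m hm d w i hw
  have hn := j.isLt
  obtain ⟨u, l, hu⟩ := OA.exists_op_comp d c w v i j
  rw [← OA.op_apply_self d w i, hw, hu]
  exact mem_radAlg.1 hx _ (OA.op_mem_EA (by omega) _ u l)

/-- A maximal ideal not containing `E_A · A` contains the radical. -/
theorem IsMaxIdeal.radAlg_le {OA : OperadAlgebraOn F O A} {M : Submodule F A}
    (hM : IsMaxIdeal OA M) (h : ∃ e ∈ EA OA, ∃ a, e a ∉ M) : radAlg OA ≤ M := by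
  by_contra hle
  obtain ⟨e, he, a, ha⟩ := h
  have htop := hM.2.2 _ (hM.1.sup (isIdealPred_radAlg OA)) (left_lt_sup.2 hle)
  obtain ⟨m, hm, r, hr, rfl⟩ := Submodule.mem_sup.1 (htop ▸ Submodule.mem_top : a ∈ M ⊔ radAlg OA)
  exact ha <| map_add e m r ▸ M.add_mem (hM.1.EA_apply_mem hm he)
    (sInf_le (a := M) hM (mem_radAlg.1 hr e he))

theorem mem_radAlg_of_forall_isMaxIdeal {OA : OperadAlgebraOn F O A} {x : A}
    (hx : ∀ M, IsMaxIdeal OA M → (∃ e ∈ EA OA, ∃ a, e a ∉ M) → x ∈ M) : x ∈ radAlg OA := by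
  refine mem_radAlg.2 fun e he => Submodule.mem_sInf.2 fun M hM => ?_
  by_contra h
  exact h (hM.1.EA_apply_mem (hx M hM ⟨e, he, x, h⟩) he)

namespace IsQuotientAlg

variable {OA : OperadAlgebraOn F O A} {I M : Submodule F A} {OQ : OperadAlgebraOn F O (A ⧸ I)}

theorem isIdealPred_comap (h : IsQuotientAlg OA I OQ) {N : Submodule F (A ⧸ I)}
    (hN : IsIdealPred OQ N) : IsIdealPred OA (N.comap I.mkQ) := fun n c v j hv => by
  rw [Submodule.mem_comap, h]
  exact hN n c _ j hv

theorem isIdealPred_map (h : IsQuotientAlg OA I OQ) (hM : IsIdealPred OA M) :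
    IsIdealPred OQ (M.map I.mkQ) := by
  refine .of_op_mem fun n c v j x hx => ?_
  obtain ⟨y, hy, rfl⟩ := hx
  choose w hw using fun k => I.mkQ_surjective (v k)
  refine ⟨OA.op c w j y, hM.op_mem c w j hy, ?_⟩
  rw [OperadAlgebraOn.op_apply, OperadAlgebraOn.op_apply, h]
  congr 1
  funext k
  by_cases hk : k = j
  · subst hk; simp
  · simp only [Function.update_of_ne hk, hw]

theorem isMaxIdeal_map (h : IsQuotientAlg OA I OQ) (hM : IsMaxIdeal OA M) (hI : I ≤ M) :
    IsMaxIdeal OQ (M.map I.mkQ) := by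
  have hc : (M.map I.mkQ).comap I.mkQ = M := by simp [Submodule.comap_map_mkQ, hI]
  refine ⟨h.isIdealPred_map hM.1, fun ht => hM.2.1 ?_, fun J hJ hlt => ?_⟩
  · rw [← hc, ht, Submodule.comap_top]
  · have := hM.2.2 _ (h.isIdealPred_comap hJ)
      (hc ▸ (Submodule.comap_strictMono_of_surjective I.mkQ_surjective hlt))
    rw [← Submodule.map_comap_eq_of_surjective I.mkQ_surjective J, this, Submodule.map_top,
      Submodule.range_mkQ]

theorem radAlg_eq_bot {OQ : OperadAlgebraOn F O (A ⧸ radAlg OA)}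
    (h : IsQuotientAlg OA (radAlg OA) OQ) : radAlg OQ = ⊥ := by
  rw [eq_bot_iff]
  intro y hy
  obtain ⟨x, rfl⟩ := (radAlg OA).mkQ_surjective y
  rw [Submodule.mem_bot, Submodule.mkQ_apply, Submodule.Quotient.mk_eq_zero]
  refine mem_radAlg_of_forall_isMaxIdeal fun M hM hE => ?_
  have hle := hM.radAlg_le hE
  have hc : (M.map (radAlg OA).mkQ).comap (radAlg OA).mkQ = M := by
    simp [Submodule.comap_map_mkQ, hle]
  obtain ⟨n, hn, c, v, j, hv⟩ : ∃ n, 2 ≤ n ∧ ∃ (c : O.C n) (v : Fin n → A) (_ : Fin n),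
      OA.α n c v ∉ M := by
    obtain ⟨e, he, a, ha⟩ := hE
    by_contra! hcon
    exact ha (OA.EA_apply_mem_iff.2 (fun n hn c v j _ => hcon n hn c v j) e he)
  rw [← hc] at hv ⊢
  refine (h.isMaxIdeal_map hM hle).radAlg_le
    ⟨_, OQ.op_mem_EA hn c (fun k => (radAlg OA).mkQ (v k)) j, (radAlg OA).mkQ (v j), ?_⟩ hy
  rwa [OQ.op_apply_self c (fun k => (radAlg OA).mkQ (v k)) j, ← h]

end IsQuotientAlg

theorem iSupIndep.isCompl_iSup_ne {ι α : Type*} [CompleteLattice α] {P : ι → α}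
    (hP : iSupIndep P) (htop : ⨆ i, P i = ⊤) (i : ι) : IsCompl (P i) (⨆ (j) (_ : j ≠ i), P j) := by
  refine ⟨hP i, codisjoint_iff.2 (eq_top_iff.2 (htop ▸ iSup_le fun j => ?_))⟩
  by_cases hj : j = i
  · exact hj ▸ le_sup_left
  · exact le_sup_of_le_right (le_iSup₂_of_le j hj le_rfl)

theorem iSupIndep.iInf_iSup_ne_eq_bot {ι R M : Type*} [Ring R] [AddCommGroup M]
    [Module R M] {P : ι → Submodule R M} (hP : iSupIndep P) (htop : ⨆ i, P i = ⊤) :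
    ⨅ i, ⨆ (j) (_ : j ≠ i), P j = ⊥ := by
  classical
  rw [eq_bot_iff]
  intro x hx
  obtain ⟨f, hf, rfl⟩ := (Submodule.mem_iSup_iff_exists_finsupp P x).1
    (htop ▸ Submodule.mem_top)
  refine Submodule.sum_mem _ fun i hi => (Submodule.mem_bot R).2 ?_
  refine Submodule.disjoint_def.1 (hP i) _ (hf i) ?_
  have hxi := (Submodule.mem_iInf _).1 hx i
  rw [Finsupp.sum, ← Finset.add_sum_erase _ _ hi] at hxi
  refine (Submodule.add_mem_iff_left _ (Submodule.sum_mem _ fun j hj => ?_)).1 hxi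
  exact Submodule.mem_iSup_of_mem j (Submodule.mem_iSup_of_mem (Finset.ne_of_mem_erase hj) (hf j))

theorem IsSimplePiece.isMaxIdeal_of_isCompl {OA : OperadAlgebraOn F O A} {P Q : Submodule F A}
    (hP : IsSimplePiece OA P) (hQ : IsIdealPred OA Q) (h : IsCompl P Q) :
    IsMaxIdeal OA Q ∧ ∃ e ∈ EA OA, ∃ a, e a ∉ Q := by
  obtain ⟨hPI, hmin, n, hn, c, v, hv, hne⟩ := hP
  have hnQ : OA.α n c v ∉ Q := fun hQv =>
    hne (Submodule.disjoint_def.1 h.disjoint _ (hPI n c v ⟨0, by omega⟩ (hv _)) hQv)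
  refine ⟨⟨hQ, fun ht => hnQ (ht ▸ Submodule.mem_top), fun J hJ hlt => ?_⟩, _,
    OA.op_mem_EA hn c v ⟨0, by omega⟩, v ⟨0, by omega⟩, by rwa [OA.op_apply_self]⟩
  rcases hmin _ inf_le_left (hPI.inf hJ) with h0 | h0
  · refine absurd (eq_of_le_of_inf_le_of_le_sup hlt.le (z := P) ?_ ?_) hlt.ne
    · rw [inf_comm, h0]
      exact bot_le
    · rw [sup_comm, h.sup_eq_top]
      exact le_top
  · rw [eq_top_iff, ← h.sup_eq_top]
    exact sup_le (inf_eq_left.1 h0) hlt.le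

theorem IsSemisimpleAlg.radAlg_eq_bot {OA : OperadAlgebraOn F O A} (h : IsSemisimpleAlg OA) :
    radAlg OA = ⊥ := by
  obtain ⟨m, P, hind, htop, hP⟩ := h
  rw [eq_bot_iff, ← hind.iInf_iSup_ne_eq_bot htop]
  refine le_iInf fun i => ?_
  obtain ⟨hM, hE⟩ := (hP i).isMaxIdeal_of_isCompl
    (.iSup fun j => .iSup fun _ => (hP j).1) (hind.isCompl_iSup_ne htop i)
  exact hM.radAlg_le hE

theorem isSemisimpleModule_of_preRad_eq_bot [FiniteDimensional F A] {OA : OperadAlgebraOn F O A}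
    (h : preRad OA = ⊥) : IsSemisimpleModule OA.mulAlg A := by
  have : IsArtinian OA.mulAlg A := isArtinian_of_tower F inferInstance
  rw [IsArtinian.isSemisimpleModule_iff_jacobson, eq_bot_iff]
  intro x hx
  refine (Submodule.mem_bot F).1 (h ▸ Submodule.mem_sInf.2 fun M hM => ?_)
  refine Submodule.mem_sInf.1 hx hM.1.toSubmodule ⟨fun ht => hM.2.1 ?_, fun J hJ => ?_⟩
  · exact eq_top_iff.2 fun y _ => hM.1.mem_toSubmodule.1 (ht ▸ Submodule.mem_top)
  · exact (Submodule.restrictScalars_eq_top_iff F _ _).1 (hM.2.2 _ (.restrictScalars J) hJ)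

theorem isSemisimpleAlg_of_radAlg_eq_bot [FiniteDimensional F A] {OA : OperadAlgebraOn F O A}
    (h : radAlg OA = ⊥) : IsSemisimpleAlg OA := by
  have hpre : preRad OA = ⊥ := le_bot_iff.1 (h ▸ preRad_le_radAlg OA)
  have := isSemisimpleModule_of_preRad_eq_bot hpre
  have : IsArtinian OA.mulAlg A := isArtinian_of_tower F inferInstance
  obtain ⟨s, hind, htop, hs⟩ := IsSemisimpleModule.exists_sSupIndep_sSup_simples_eq_top OA.mulAlg A
  have : Finite s := WellFoundedLT.finite_of_sSupIndep hind
  obtain ⟨m, ⟨f⟩⟩ := Finite.exists_equiv_fin s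
  let φ := Submodule.restrictScalarsLatticeHom F OA.mulAlg A
  let N : Fin m → Submodule OA.mulAlg A := fun i => (f.symm i).1
  have hNind : iSupIndep N := ((sSupIndep_iff s).1 hind).comp f.symm.injective
  have hNtop : ⨆ i, N i = ⊤ := by
    rw [← htop, sSup_eq_iSup']
    exact f.symm.iSup_comp (g := fun x : s => (x : Submodule OA.mulAlg A))
  have hcompl (i : Fin m) : IsCompl (φ (N i)) (φ (⨆ (j) (_ : j ≠ i), N j)) :=
    (hNind.isCompl_iSup_ne hNtop i).map φ
  refine ⟨m, fun i => φ (N i), fun i => ?_, by rw [← map_iSup, hNtop, map_top], fun i => ?_⟩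
  · simpa only [map_iSup] using (hcompl i).disjoint
  have hatom : IsAtom (N i) := isSimpleModule_iff_isAtom.1 (hs _ (f.symm i).2)
  refine ⟨.restrictScalars _, fun J hJ hJI => ?_, ?_⟩
  · refine (hatom.le_iff (x := hJI.toSubmodule)).1 hJ |>.imp (fun h => ?_) fun h => ?_
    · exact congrArg (Submodule.restrictScalars F) h
    · exact congrArg (Submodule.restrictScalars F) h
  · obtain ⟨x, hx, hx0⟩ := Submodule.exists_mem_ne_zero_of_ne_bot hatom.1
    have hxr : x ∉ radAlg OA := h ▸ hx0
    rw [mem_radAlg, hpre, OA.EA_apply_mem_iff] at hxr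
    push Not at hxr
    obtain ⟨n, hn, c, v, j, rfl, hv⟩ := hxr
    obtain ⟨w, hw, hvw⟩ := IsIdealPred.exists_eq_of_isCompl (.restrictScalars _)
      (.restrictScalars _) (hcompl i) c v j hx
    exact ⟨n, hn, c, w, hw, hvw ▸ hv⟩

/-- `Ā = A / Rad(A)` is a semisimple `C`-algebra; in particular `A` is
semisimple iff `Rad(A) = 0`. -/
theorem quotient_by_radical_semisimple {F : Type} [Field F] {O : LinearOperadData F}
    {A : Type} [AddCommGroup A] [Module F A] [FiniteDimensional F A]
    (OA : OperadAlgebraOn F O A)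
    (OQ : OperadAlgebraOn F O (A ⧸ radAlg OA))
    (hOQ : IsQuotientAlg OA (radAlg OA) OQ) :
    IsSemisimpleAlg OQ ∧ (IsSemisimpleAlg OA ↔ radAlg OA = ⊥) := by
  exact ⟨isSemisimpleAlg_of_radAlg_eq_bot hOQ.radAlg_eq_bot,
    fun h => h.radAlg_eq_bot, isSemisimpleAlg_of_radAlg_eq_bot⟩
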